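/- Let R be a commutative local ring with maximal ideal I, A a finitely generated R-module, w : A → ℕ a weight function, and z_1,…,z_t a minimal basis of A. Let p ≥ 1 be an integer. Then for every generating set x_1,…,x_r of A (so necessarily r ≥ t), one has p^{w(x_1)} + … + p^{w(x_r)} ≥ p^{w(z_1)} + … + p^{w(z_t)} + (r − t). -/

import Mathlib

/-- A *basis* of a module `A`: a finite generating set no proper subset of which
generates `A`. -/
def IsBasisSet (R : Type*) {A : Type*} [CommRing R] [AddCommGroup A] [Module R A]
    (S : Finset A) : Prop :=
  Submodule.span R (S : Set A) = ⊤ ∧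
    ∀ T : Finset A, T ⊂ S → Submodule.span R (T : Set A) ≠ ⊤

/-- The *profile* of a finite subset of `A` with respect to a weight function `w`:
the list of weights of its elements, sorted in non-decreasing order. -/
def weightProfile {A : Type*} (w : A → ℕ) (S : Finset A) : List ℕ :=
  (S.val.map w).sort (· ≤ ·)

/-- Every finite generating set contains a basis. -/
lemma exists_isBasisSet_subset {R A : Type*} [CommRing R] [AddCommGroup A] [Module R A]
    {S : Finset A} (hS : Submodule.span R (S : Set A) = ⊤) :
    ∃ B ⊆ S, IsBasisSet R B := by
  obtain ⟨B, hBS, hB⟩ := exists_minimal_le_of_wellFoundedLT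
    (fun T : Finset A => Submodule.span R (T : Set A) = ⊤) S hS
  exact ⟨B, hBS, hB.prop, fun T hT hspan => hB.not_prop_of_lt hT hspan⟩

lemma length_weightProfile {A : Type*} (w : A → ℕ) (S : Finset A) :
    (weightProfile w S).length = S.card := by
  simp [weightProfile]

lemma sum_map_weightProfile {A : Type*} (w : A → ℕ) (g : ℕ → ℕ) (S : Finset A) :
    ((weightProfile w S).map g).sum = ∑ a ∈ S, g (w a) := by
  rw [← Multiset.sum_coe, ← Multiset.map_coe, weightProfile, Multiset.sort_eq, Multiset.map_map]
  rfl

/-- If `z_1, …, z_t` is a minimal basis of a finitely generated module `A` over a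
commutative local ring and `p ≥ 1`, then for every generating set `x_1, …, x_r` of
`A` we have `p^{w(x_1)} + … + p^{w(x_r)} ≥ p^{w(z_1)} + … + p^{w(z_t)} + (r - t)`. -/
theorem stmt5 {R A : Type*} [CommRing R] [IsLocalRing R] [AddCommGroup A] [Module R A]
    [Module.Finite R A] [DecidableEq A] (w : A → ℕ) (p : ℕ) (hp : 1 ≤ p)
    (t : ℕ) (z : Fin t → A) (hzinj : Function.Injective z)
    (hzB : IsBasisSet R (Finset.image z Finset.univ))
    (hzmin : ∀ B : Finset A, IsBasisSet R B →
      List.Forall₂ (· ≤ ·) (weightProfile w (Finset.image z Finset.univ))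
        (weightProfile w B))
    (r : ℕ) (x : Fin r → A) (hxinj : Function.Injective x)
    (hxgen : Submodule.span R (Set.range x) = ⊤) :
    (∑ j, p ^ w (z j)) + (r - t) ≤ ∑ i, p ^ w (x i) := by
  have hX : Submodule.span R ((Finset.univ.image x : Finset A) : Set A) = ⊤ := by
    simpa using hxgen
  obtain ⟨B, hBX, hB⟩ := exists_isBasisSet_subset hX
  have hprofile := hzmin B hB
  have hcardZ : (Finset.univ.image z).card = t := by
    simp [Finset.card_image_of_injective _ hzinj]
  have hcardX : (Finset.univ.image x).card = r := by
    simp [Finset.card_image_of_injective _ hxinj]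
  have hcardB : B.card = t := by
    rw [← hcardZ, ← length_weightProfile w, ← length_weightProfile w, hprofile.length_eq]
  have hsumB : ∑ j, p ^ w (z j) ≤ ∑ b ∈ B, p ^ w b := by
    rw [← Finset.sum_image (f := fun a => p ^ w a) hzinj.injOn,
      ← sum_map_weightProfile w (p ^ ·), ← sum_map_weightProfile w (p ^ ·)]
    refine List.Forall₂.sum_le_sum ?_
    simp only [List.forall₂_map_left_iff, List.forall₂_map_right_iff]
    exact hprofile.imp fun _ _ hab => Nat.pow_le_pow_right hp hab
  have hsumC : r - t ≤ ∑ a ∈ Finset.univ.image x \ B, p ^ w a := by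
    have hcard := Finset.card_sdiff_of_subset hBX
    rw [hcardX, hcardB, Finset.card_eq_sum_ones] at hcard
    rw [← hcard]
    exact Finset.sum_le_sum fun a _ => Nat.one_le_pow _ _ hp
  calc (∑ j, p ^ w (z j)) + (r - t)
      ≤ (∑ a ∈ B, p ^ w a) + ∑ a ∈ Finset.univ.image x \ B, p ^ w a :=
        add_le_add hsumB hsumC
    _ = ∑ a ∈ Finset.univ.image x, p ^ w a := by
        rw [add_comm, Finset.sum_sdiff hBX]
    _ = ∑ i, p ^ w (x i) := Finset.sum_image hxinj.injOn
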